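/- The following are equivalent: (i) (A, A*, A^ε) is a Leonard triple on 𝕂^{d+1}; (ii) A^ε is multiplicity-free, i.e. A^ε has d+1 mutually distinct eigenvalues; (iii) c² ≠ q^{2d−2i} for all 1 ≤ i ≤ 2d−1. -/

import Mathlib

/-- θ_i = a·q^{2i−d} + a^{−1}·q^{d−2i}. -/
noncomputable def qθ {K : Type*} [Field K] (d : ℕ) (a q : K) (i : ℕ) : K :=
  a * q ^ (2 * (i : ℤ) - (d : ℤ)) + a⁻¹ * q ^ ((d : ℤ) - 2 * (i : ℤ))

/-- The first split sequence φ_i of QRacah type. -/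
noncomputable def qφ {K : Type*} [Field K] (d : ℕ) (a b c q : K) (i : ℕ) : K :=
  a⁻¹ * b⁻¹ * q ^ ((d : ℤ) + 1) * (q ^ (i : ℤ) - q ^ (-(i : ℤ))) *
    (q ^ ((i : ℤ) - (d : ℤ) - 1) - q ^ ((d : ℤ) - (i : ℤ) + 1)) *
    (q ^ (-(i : ℤ)) - a * b * c * q ^ ((i : ℤ) - (d : ℤ) - 1)) *
    (q ^ (-(i : ℤ)) - a * b * c⁻¹ * q ^ ((i : ℤ) - (d : ℤ) - 1))

/-- The second split sequence ϕ_i of QRacah type. -/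
noncomputable def qϕ {K : Type*} [Field K] (d : ℕ) (a b c q : K) (i : ℕ) : K :=
  a * b⁻¹ * q ^ ((d : ℤ) + 1) * (q ^ (i : ℤ) - q ^ (-(i : ℤ))) *
    (q ^ ((i : ℤ) - (d : ℤ) - 1) - q ^ ((d : ℤ) - (i : ℤ) + 1)) *
    (q ^ (-(i : ℤ)) - a⁻¹ * b * c * q ^ ((i : ℤ) - (d : ℤ) - 1)) *
    (q ^ (-(i : ℤ)) - a⁻¹ * b * c⁻¹ * q ^ ((i : ℤ) - (d : ℤ) - 1))

/-- Parameter array over 𝕂 of diameter d: conditions (PA1)–(PA5). -/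
def IsParameterArray {K : Type*} [Field K] (d : ℕ) (θ θs φ ϕ : ℕ → K) : Prop :=
  (∀ i, i ≤ d → ∀ j, j ≤ d → i ≠ j → θ i ≠ θ j ∧ θs i ≠ θs j) ∧
  (∀ i, 1 ≤ i → i ≤ d → φ i ≠ 0 ∧ ϕ i ≠ 0) ∧
  (∀ i, 1 ≤ i → i ≤ d →
    φ i = ϕ 1 * (∑ h ∈ Finset.range i, (θ h - θ (d - h)) / (θ 0 - θ d)) +
      (θs i - θs 0) * (θ (i - 1) - θ d)) ∧
  (∀ i, 1 ≤ i → i ≤ d →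
    ϕ i = φ 1 * (∑ h ∈ Finset.range i, (θ h - θ (d - h)) / (θ 0 - θ d)) +
      (θs i - θs 0) * (θ (d - i + 1) - θ 0)) ∧
  (∃ β : K, ∀ i, 2 ≤ i → i + 1 ≤ d →
    (θ (i - 2) - θ (i + 1)) / (θ (i - 1) - θ i) = β ∧
    (θs (i - 2) - θs (i + 1)) / (θs (i - 1) - θs i) = β)

/-- The set QRAC_red: conditions (RQRAC1)–(RQRAC4). -/
def QRACred {K : Type*} [Field K] (d : ℕ) (a b c q : K) : Prop :=
  (a ≠ 0 ∧ b ≠ 0 ∧ c ≠ 0 ∧ q ≠ 0) ∧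
  (∀ i : ℕ, 1 ≤ i → i ≤ d → q ^ (2 * i) ≠ 1) ∧
  (∀ i : ℕ, 1 ≤ i → i ≤ 2 * d - 1 →
    a ^ 2 ≠ q ^ (2 * (d : ℤ) - 2 * (i : ℤ)) ∧ b ^ 2 ≠ q ^ (2 * (d : ℤ) - 2 * (i : ℤ))) ∧
  (∀ i : ℕ, 1 ≤ i → i ≤ d →
    a * b * c ≠ q ^ ((d : ℤ) - 2 * (i : ℤ) + 1) ∧
    a⁻¹ * b * c ≠ q ^ ((d : ℤ) - 2 * (i : ℤ) + 1) ∧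
    a * b⁻¹ * c ≠ q ^ ((d : ℤ) - 2 * (i : ℤ) + 1) ∧
    a * b * c⁻¹ ≠ q ^ ((d : ℤ) - 2 * (i : ℤ) + 1))

/-- The lower bidiagonal matrix A with A_{ii} = θ_i and A_{i,i−1} = 1. -/
noncomputable def matA {K : Type*} [Field K] (d : ℕ) (a q : K) :
    Matrix (Fin (d + 1)) (Fin (d + 1)) K :=
  Matrix.of fun i j =>
    if (i : ℕ) = (j : ℕ) then qθ d a q (i : ℕ)
    else if (i : ℕ) = (j : ℕ) + 1 then 1 else 0

/-- The upper bidiagonal matrix A* with A*_{ii} = θ*_i and A*_{i−1,i} = φ_i. -/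
noncomputable def matAs {K : Type*} [Field K] (d : ℕ) (a b c q : K) :
    Matrix (Fin (d + 1)) (Fin (d + 1)) K :=
  Matrix.of fun i j =>
    if (i : ℕ) = (j : ℕ) then qθ d b q (i : ℕ)
    else if (j : ℕ) = (i : ℕ) + 1 then qφ d a b c q (j : ℕ) else 0

/-- A^ε = (q^{−1}·A*A − q·AA*)/(q²−q^{−2})
      + ((a+a^{−1})(b+b^{−1}) + (c+c^{−1})(q^{d+1}+q^{−d−1}))/(q+q^{−1}) · I. -/
noncomputable def matAe {K : Type*} [Field K] (d : ℕ) (a b c q : K) :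
    Matrix (Fin (d + 1)) (Fin (d + 1)) K :=
  (q ^ 2 - q ^ (-2 : ℤ))⁻¹ •
      (q⁻¹ • (matAs d a b c q * matA d a q) - q • (matA d a q * matAs d a b c q)) +
    (((a + a⁻¹) * (b + b⁻¹) + (c + c⁻¹) * (q ^ ((d : ℤ) + 1) + q ^ (-(d : ℤ) - 1))) /
        (q + q⁻¹)) • (1 : Matrix (Fin (d + 1)) (Fin (d + 1)) K)

/-- A square matrix is tridiagonal when each nonzero entry lies on the diagonal,
subdiagonal or superdiagonal. -/
def IsTrid {K : Type*} [Field K] {n : ℕ} (X : Matrix (Fin n) (Fin n) K) : Prop :=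
  ∀ i j : Fin n, X i j ≠ 0 →
    (i : ℕ) = (j : ℕ) ∨ (i : ℕ) = (j : ℕ) + 1 ∨ (j : ℕ) = (i : ℕ) + 1

/-- A tridiagonal matrix is irreducible when every subdiagonal and every
superdiagonal entry is nonzero. -/
def IsIrredTrid {K : Type*} [Field K] {n : ℕ} (X : Matrix (Fin n) (Fin n) K) : Prop :=
  IsTrid X ∧ ∀ i j : Fin n, ((i : ℕ) = (j : ℕ) + 1 ∨ (j : ℕ) = (i : ℕ) + 1) → X i j ≠ 0

/-- There is an invertible S making X diagonal and Y, Z irreducible tridiagonal. -/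
def LTcond {K : Type*} [Field K] {n : ℕ} (X Y Z : Matrix (Fin n) (Fin n) K) : Prop :=
  ∃ S : Matrix (Fin n) (Fin n) K, IsUnit S ∧
    (S⁻¹ * X * S).IsDiag ∧ IsIrredTrid (S⁻¹ * Y * S) ∧ IsIrredTrid (S⁻¹ * Z * S)

/-- (B₁,B₂,B₃) is a Leonard triple on 𝕂^n. -/
def IsLeonardTriple {K : Type*} [Field K] {n : ℕ}
    (B₁ B₂ B₃ : Matrix (Fin n) (Fin n) K) : Prop :=
  LTcond B₁ B₂ B₃ ∧ LTcond B₂ B₃ B₁ ∧ LTcond B₃ B₁ B₂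

/-- A matrix is multiplicity-free when its characteristic polynomial has
mutually distinct roots. -/
def MultFree {K : Type*} [Field K] {n : ℕ} (X : Matrix (Fin n) (Fin n) K) : Prop :=
  ∃ e : Fin n → K, Function.Injective e ∧
    X.charpoly = ∏ i : Fin n, (Polynomial.X - Polynomial.C (e i))

/-- The part of the conditions on `(a, b, c; q)` that is invariant under the rotation
`(a, b, c) ↦ (c, a⁻¹, b)`. -/
def IsSplitAdmissible {K : Type*} [Field K] (d : ℕ) (a b c q : K) : Prop :=
  (a ≠ 0 ∧ b ≠ 0 ∧ c ≠ 0 ∧ q ≠ 0) ∧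
  (∀ i : ℕ, 1 ≤ i → i ≤ d → q ^ (2 * i) ≠ 1) ∧
  (∀ i : ℕ, 1 ≤ i → i ≤ d →
    a * b * c ≠ q ^ ((d : ℤ) - 2 * (i : ℤ) + 1) ∧
    a⁻¹ * b * c ≠ q ^ ((d : ℤ) - 2 * (i : ℤ) + 1) ∧
    a * b⁻¹ * c ≠ q ^ ((d : ℤ) - 2 * (i : ℤ) + 1) ∧
    a * b * c⁻¹ ≠ q ^ ((d : ℤ) - 2 * (i : ℤ) + 1))

/-- The tridiagonal matrix with `(i, i - 1)`-entry `l i`, `(i, i)`-entry `m i` and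
`(i - 1, i)`-entry `u i`. -/
def tridiag {K : Type*} [Field K] (d : ℕ) (l m u : ℕ → K) :
    Matrix (Fin (d + 1)) (Fin (d + 1)) K :=
  Matrix.of fun i j =>
    if (i : ℕ) = (j : ℕ) then m i
    else if (i : ℕ) = (j : ℕ) + 1 then l i
    else if (j : ℕ) = (i : ℕ) + 1 then u j else 0

/-- The square matrix obtained by restricting a doubly indexed family. -/
def natMat {K : Type*} (d : ℕ) (p : ℕ → ℕ → K) : Matrix (Fin (d + 1)) (Fin (d + 1)) K :=
  Matrix.of fun i j => p i j

/-- The diagonal entries of `matAe`. -/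
noncomputable def diagAe {K : Type*} [Field K] (d : ℕ) (a b c q : K) (i : ℕ) : K :=
  (q ^ 2 - q ^ (-2 : ℤ))⁻¹ *
      ((q⁻¹ - q) * (qθ d a q i * qθ d b q i) + q⁻¹ * qφ d a b c q (i + 1) -
        q * qφ d a b c q i) +
    ((a + a⁻¹) * (b + b⁻¹) + (c + c⁻¹) * (q ^ ((d : ℤ) + 1) + q ^ (-(d : ℤ) - 1))) /
        (q + q⁻¹)

section Entries

variable {K : Type*} [Field K] {d : ℕ}

theorem sum_fin_ite_eq (n t : ℕ) (f : ℕ → K) :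
    ∑ k : Fin n, (if (k : ℕ) = t then f k else 0) = if t < n then f t else 0 := by
  rw [Fin.sum_univ_eq_sum_range (fun k => if k = t then f k else 0) n]
  simp [Finset.sum_ite_eq']

theorem tridiag_mul (l m u : ℕ → K) (p : ℕ → ℕ → K) (i j : Fin (d + 1)) :
    (tridiag d l m u * natMat d p) i j =
      m i * p i j + (if (i : ℕ) = 0 then 0 else l i * p (i - 1) j) +
        (if (i : ℕ) < d then u (i + 1) * p (i + 1) j else 0) := by
  have key : ∀ k : Fin (d + 1), tridiag d l m u i k * p k j =
      (if (k : ℕ) = i then m i * p k j else 0) +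
      (if (k : ℕ) = i - 1 then (if (i : ℕ) = 0 then 0 else l i * p k j) else 0) +
      (if (k : ℕ) = i + 1 then u k * p k j else 0) := by
    intro k
    simp only [tridiag, Matrix.of_apply]
    split_ifs <;> first | omega | simp
  have hi := i.isLt
  simp only [Matrix.mul_apply, natMat, Matrix.of_apply, key, Finset.sum_add_distrib]
  rw [sum_fin_ite_eq _ _ (fun k => m i * p k j),
    sum_fin_ite_eq _ _ (fun k => if (i : ℕ) = 0 then 0 else l i * p k j),
    sum_fin_ite_eq _ _ (fun k => u k * p k j), if_pos hi, if_pos (by omega)]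
  simp

theorem mul_tridiag (l m u : ℕ → K) (p : ℕ → ℕ → K) (i j : Fin (d + 1)) :
    (natMat d p * tridiag d l m u) i j =
      p i j * m j + (if (j : ℕ) < d then p i (j + 1) * l (j + 1) else 0) +
        (if (j : ℕ) = 0 then 0 else p i (j - 1) * u j) := by
  have key : ∀ k : Fin (d + 1), p i k * tridiag d l m u k j =
      (if (k : ℕ) = j then p i k * m j else 0) +
      (if (k : ℕ) = j + 1 then p i k * l k else 0) +
      (if (k : ℕ) = j - 1 then (if (j : ℕ) = 0 then 0 else p i k * u j) else 0) := by
    intro k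
    simp only [tridiag, Matrix.of_apply]
    split_ifs with h1 <;> first | omega | simp [h1]
  have hj := j.isLt
  simp only [Matrix.mul_apply, natMat, Matrix.of_apply, key, Finset.sum_add_distrib]
  rw [sum_fin_ite_eq _ _ (fun k => p i k * m j),
    sum_fin_ite_eq _ _ (fun k => p i k * l k),
    sum_fin_ite_eq _ _ (fun k => if (j : ℕ) = 0 then 0 else p i k * u j), if_pos hj,
    if_pos (show (j : ℕ) - 1 < d + 1 by omega)]
  simp

theorem matA_eq_tridiag (a q : K) :
    matA d a q = tridiag d (fun _ => 1) (qθ d a q) (fun _ => 0) := by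
  ext i j
  simp [matA, tridiag]

theorem matAs_eq_tridiag (a b c q : K) :
    matAs d a b c q = tridiag d (fun _ => 0) (qθ d b q) (qφ d a b c q) := by
  ext i j
  simp only [matAs, tridiag, Matrix.of_apply]
  split_ifs <;> first | rfl | omega

theorem qφ_zero (a b c q : K) : qφ d a b c q 0 = 0 := by simp [qφ]

theorem qφ_succ_self (a b c q : K) : qφ d a b c q (d + 1) = 0 := by simp [qφ]

theorem qθ_comb_lower {a q : K} (ha : a ≠ 0) (hq : q ≠ 0) (i : ℕ) :
    q⁻¹ * qθ d a q (i + 1) - q * qθ d a q i =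
      -(q ^ 2 - q ^ (-2 : ℤ)) * (a⁻¹ * q ^ ((d : ℤ) - 2 * i - 1)) := by
  simp only [qθ, zpow_sub₀ hq, zpow_add₀ hq, zpow_neg, two_mul, zpow_one, Nat.cast_add,
    Nat.cast_one, show (-2 : ℤ) = -1 + -1 by norm_num]
  field_simp
  ring

theorem qθ_comb_upper {a q : K} (ha : a ≠ 0) (hq : q ≠ 0) (i : ℕ) :
    q⁻¹ * qθ d a q i - q * qθ d a q (i + 1) =
      -(q ^ 2 - q ^ (-2 : ℤ)) * (a * q ^ (2 * (i : ℤ) + 1 - d)) := by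
  simp only [qθ, zpow_sub₀ hq, zpow_add₀ hq, zpow_neg, two_mul, zpow_one, Nat.cast_add,
    Nat.cast_one, show (-2 : ℤ) = -1 + -1 by norm_num]
  field_simp
  ring

theorem matAe_eq_tridiag {a b c q : K} (ha : a ≠ 0) (hb : b ≠ 0) (hq : q ≠ 0)
    (h4 : q ^ 2 - q ^ (-2 : ℤ) ≠ 0) :
    matAe d a b c q = tridiag d (fun i => -(b⁻¹ * q ^ ((d : ℤ) - 2 * i + 1)))
      (diagAe d a b c q) (fun i => -(a⁻¹ * q ^ ((d : ℤ) - 2 * i + 1)) * qφ d a b c q i) := by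
  ext i j
  have e1 : matA d a q = natMat d
      (fun i j : ℕ => if i = j then qθ d a q i else if i = j + 1 then 1 else 0) := rfl
  have L := qθ_comb_lower (d := d) hb hq j
  have U := qθ_comb_lower (d := d) ha hq i
  have hi := i.isLt
  have hj := j.isLt
  have hφ : ¬ ((i : ℕ) < d) → qφ d a b c q (i + 1) = 0 := fun h => by
    rw [show (i : ℕ) = d by omega, qφ_succ_self]
  have hφ0 : (i : ℕ) = 0 → qφ d a b c q i = 0 := fun h => by rw [h, qφ_zero]
  simp only [matAe, Matrix.add_apply, Matrix.smul_apply, Matrix.sub_apply, smul_eq_mul]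
  rw [matAs_eq_tridiag, e1, tridiag_mul, mul_tridiag]
  simp only [tridiag, Matrix.of_apply, Matrix.one_apply, Fin.ext_iff]
  simp only [diagAe]
  generalize q ^ 2 - q ^ (-2 : ℤ) = D at *
  rcases lt_trichotomy (i : ℕ) (j : ℕ) with hij | hij | hij
  · by_cases h : (j : ℕ) = i + 1
    · have e : (i : ℕ) < d := by omega
      simp [h, e, show ¬ (i : ℕ) = i + 1 + 1 by omega]
      rw [show (d : ℤ) - 2 * (i + 1) + 1 = d - 2 * i - 1 by ring, inv_mul_eq_iff_eq_mul₀ h4]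
      linear_combination (qφ d a b c q (i + 1)) * U
    · have e5 : ¬ (i : ℕ) = j := by omega
      have e6 : ¬ (i : ℕ) = j + 1 := by omega
      have e7 : ¬ (i : ℕ) + 1 = j := by omega
      have e8 : ¬ (i : ℕ) = j - 1 := by omega
      have e9 : ¬ (i : ℕ) - 1 = j := by omega
      have e10 : ¬ (i : ℕ) - 1 = j + 1 := by omega
      have e11 : ¬ (i : ℕ) = j - 1 + 1 := by omega
      simp [h, e5, e6, e7, e8, e9, e10, e11]
  · have e : (if (j : ℕ) < d then qφ d a b c q (j + 1) else 0) = qφ d a b c q (j + 1) := by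
      by_cases h : (j : ℕ) < d
      · simp [h]
      · simp [hφ (by omega), ← hij]
    have e' : (if (j : ℕ) = 0 then 0 else qφ d a b c q j) = qφ d a b c q j := by
      by_cases h : (j : ℕ) = 0
      · simp [h, qφ_zero]
      · simp [h]
    have e'' : (if (j : ℕ) = 0 then 0 else (if (j : ℕ) = j - 1 then qθ d a q j
        else if (j : ℕ) = j - 1 + 1 then 1 else 0) * qφ d a b c q j) = qφ d a b c q j := by
      rw [← e']
      split_ifs <;> first | omega | simp
    simp only [hij, e'']
    simp [e]
    left
    ring
  · by_cases h : (i : ℕ) = j + 1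
    · have e : (j : ℕ) < d := by omega
      simp [h, e, show ¬ (j : ℕ) + 1 + 1 = j by omega, -Fin.val_eq_zero_iff]
      rw [show (d : ℤ) - 2 * (j + 1) + 1 = d - 2 * j - 1 by ring, inv_mul_eq_iff_eq_mul₀ h4]
      split_ifs <;> first | omega | linear_combination L
    · have e5 : ¬ (i : ℕ) = j := by omega
      have e6 : ¬ (j : ℕ) = i + 1 := by omega
      have e7 : ¬ (i : ℕ) + 1 = j := by omega
      have e8 : ¬ (i : ℕ) = j - 1 := by omega
      have e9 : ¬ (i : ℕ) - 1 = j := by omega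
      have e11 : ¬ (i : ℕ) = j - 1 + 1 := by omega
      simp [h, e5, e6, e7, e8, e9, e11]

end Entries

section Rotation

variable {K : Type*} [Field K]

/-- Ratio of consecutive column factors of `splitP`. -/
noncomputable def splitCol (d : ℕ) (a b c q : K) (i : ℕ) : K :=
  -c⁻¹ * q * (q ^ ((d : ℤ) - i) - q ^ ((i : ℤ) - d)) *
    (q ^ (-(i : ℤ) - 1) - a⁻¹ * b⁻¹ * c * q ^ ((i : ℤ) - d))

/-- Ratio of consecutive row factors of `splitP`. -/
noncomputable def splitRow (d : ℕ) (a b c q : K) (m : ℕ) : K :=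
  -b * c * q ^ (-(m : ℤ) - 1) * (1 - a⁻¹ * b⁻¹ * c⁻¹ * q ^ (2 * (m : ℤ) + 1 - d))

/-- The transition coefficients between the split bases for `(a, b, c)` and `(c, a⁻¹, b)`. -/
noncomputable def splitP (d : ℕ) (a b c q : K) (m i : ℕ) : K :=
  (∏ k ∈ Finset.range i, splitCol d a b c q k) * (∏ k ∈ Finset.range m, splitRow d a b c q k) *
    ∏ l ∈ Finset.range m, ((q ^ ((i : ℤ) - l) - q ^ ((l : ℤ) - i)) * q ^ (i : ℤ))

theorem splitP_row_succ (d : ℕ) (a b c q : K) (m i : ℕ) :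
    splitP d a b c q (m + 1) i = splitRow d a b c q m *
      ((q ^ ((i : ℤ) - m) - q ^ ((m : ℤ) - i)) * q ^ (i : ℤ)) * splitP d a b c q m i := by
  simp only [splitP, Finset.prod_range_succ]
  ring

theorem splitP_succ_succ (d : ℕ) (a b c : K) {q : K} (hq : q ≠ 0) (m i : ℕ) :
    splitP d a b c q (m + 1) (i + 1) = splitCol d a b c q i * splitRow d a b c q m *
      ((q ^ ((i : ℤ) + 1) - q ^ (-(i : ℤ) - 1)) * q ^ ((i : ℤ) + 1 + m)) *
        splitP d a b c q m i := by
  have key : ∏ l ∈ Finset.range m,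
      ((q ^ (((i + 1 : ℕ) : ℤ) - (l + 1 : ℕ)) - q ^ (((l + 1 : ℕ) : ℤ) - (i + 1 : ℕ))) *
        q ^ ((i + 1 : ℕ) : ℤ)) =
      q ^ (m : ℤ) * ∏ l ∈ Finset.range m,
        ((q ^ ((i : ℤ) - l) - q ^ ((l : ℤ) - i)) * q ^ (i : ℤ)) := by
    have hm : q ^ (m : ℤ) = ∏ _l ∈ Finset.range m, q := by simp
    rw [hm, ← Finset.prod_mul_distrib]
    refine Finset.prod_congr rfl fun l _ => ?_
    push_cast
    rw [add_sub_add_right_eq_sub, add_sub_add_right_eq_sub, zpow_add_one₀ hq]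
    ring
  simp only [splitP]
  rw [Finset.prod_range_succ' (fun l : ℕ => (q ^ (((i + 1 : ℕ) : ℤ) - l) -
    q ^ ((l : ℤ) - (i + 1 : ℕ))) * q ^ ((i + 1 : ℕ) : ℤ)), key, Finset.prod_range_succ,
    Finset.prod_range_succ]
  push_cast
  rw [sub_zero, show (0 : ℤ) - (i + 1) = -i - 1 by ring, zpow_add₀ hq (i + 1)]
  ring

theorem splitP_zero_succ (d : ℕ) (a b c q : K) (i : ℕ) :
    splitP d a b c q 0 (i + 1) = splitCol d a b c q i * splitP d a b c q 0 i := by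
  simp [splitP, Finset.prod_range_succ, mul_comm]

theorem splitP_succ_zero (d : ℕ) (a b c q : K) (m : ℕ) :
    splitP d a b c q (m + 1) 0 = 0 := by
  simp [splitP, Finset.prod_range_succ']

theorem splitP_col_succ_self (d : ℕ) (a b c q : K) (m : ℕ) :
    splitP d a b c q m (d + 1) = 0 := by
  simp [splitP, Finset.prod_range_succ, splitCol]

/-- Entrywise form of `A P = P A*(c, a⁻¹, b)` in column `i + 1`. -/
theorem splitP_matA {a b c q : K} (ha : a ≠ 0) (hb : b ≠ 0) (hc : c ≠ 0) (hq : q ≠ 0)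
    (j m i : ℕ) :
    (qθ (j + m) a q j - qθ (j + m) a⁻¹ q (i + 1)) * splitP (j + m) a b c q m (i + 1) +
      splitP (j + m) a b c q (m + 1) (i + 1) =
    qφ (j + m) c a⁻¹ b q (i + 1) * splitP (j + m) a b c q m i := by
  rcases m with _ | m
  · rw [splitP_succ_succ _ _ _ _ hq, splitP_zero_succ]
    generalize splitP _ a b c q 0 i = t
    have hI := zpow_ne_zero (i : ℤ) hq
    have hJ := zpow_ne_zero (j : ℤ) hq
    simp only [qθ, qφ, splitRow, splitCol, Nat.cast_add, Nat.cast_one, Nat.cast_zero, two_mul,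
      neg_add, zpow_sub₀ hq, zpow_add₀ hq, zpow_neg, add_zero, zpow_zero, zpow_one]
    generalize q ^ (i : ℤ) = I at *
    generalize q ^ (j : ℤ) = J at *
    field_simp
    ring
  · rw [splitP_succ_succ _ _ _ _ hq, splitP_succ_succ _ _ _ _ hq, splitP_row_succ]
    generalize splitP _ a b c q m i = t
    have hI := zpow_ne_zero (i : ℤ) hq
    have hJ := zpow_ne_zero (j : ℤ) hq
    have hM := zpow_ne_zero (m : ℤ) hq
    simp only [qθ, qφ, splitRow, splitCol, Nat.cast_add, Nat.cast_one, two_mul,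
      neg_add, zpow_sub₀ hq, zpow_add₀ hq, zpow_neg, zpow_one]
    generalize q ^ (i : ℤ) = I at *
    generalize q ^ (j : ℤ) = J at *
    generalize q ^ (m : ℤ) = M at *
    field_simp
    ring

/-- Entrywise form of `A P = P A*(c, a⁻¹, b)` in column `0`. -/
theorem splitP_matA_zero {a b c q : K} (j m : ℕ) :
    (qθ (j + m) a q j - qθ (j + m) a⁻¹ q 0) * splitP (j + m) a b c q m 0 +
      splitP (j + m) a b c q (m + 1) 0 = 0 := by
  rw [splitP_succ_zero]
  rcases m with _ | m
  · simp only [qθ, add_zero, inv_inv, Nat.cast_zero, mul_zero, zero_sub, sub_zero, two_mul,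
      add_sub_cancel_right, sub_add_cancel_left]
    ring
  · rw [splitP_succ_zero]
    ring

theorem diagAe_eq {a b c q : K} (d : ℕ) (h4 : q ^ 2 - q⁻¹ ^ 2 ≠ 0) (i : ℕ) :
    diagAe d a b c q i = (q ^ 2 - q⁻¹ ^ 2)⁻¹ *
      ((q⁻¹ - q) * (qθ d a q i * qθ d b q i) + q⁻¹ * qφ d a b c q (i + 1) -
        q * qφ d a b c q i + (q - q⁻¹) * ((a + a⁻¹) * (b + b⁻¹) +
          (c + c⁻¹) * (q ^ ((d : ℤ) + 1) + q ^ (-(d : ℤ) - 1)))) := by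
  have e : q ^ 2 - q⁻¹ ^ 2 = (q - q⁻¹) * (q + q⁻¹) := by ring
  have h1 : q - q⁻¹ ≠ 0 := fun h => h4 (by rw [e, h, zero_mul])
  have h2 : q + q⁻¹ ≠ 0 := fun h => h4 (by rw [e, h, mul_zero])
  rw [diagAe, show (q ^ (-2 : ℤ)) = q⁻¹ ^ 2 by rw [zpow_neg, inv_pow, zpow_ofNat], e,
    mul_add _ _ ((q - q⁻¹) * _)]
  congr 1
  rw [mul_inv, div_eq_inv_mul, mul_mul_mul_comm, inv_mul_cancel₀ h1, one_mul]

/-- Entrywise form of `A^ε P = P A(c)`. -/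
theorem splitP_matAe {a b c q : K} (ha : a ≠ 0) (hb : b ≠ 0) (hc : c ≠ 0) (hq : q ≠ 0)
    (h4 : q ^ 2 - q⁻¹ ^ 2 ≠ 0) (j m i : ℕ) :
    -(b⁻¹ * q ^ (((j + m : ℕ) : ℤ) - 2 * (j : ℤ) + 1)) * splitP (j + m) a b c q (m + 1) i +
      diagAe (j + m) a b c q j * splitP (j + m) a b c q m i +
      -(a⁻¹ * q ^ (((j + m : ℕ) : ℤ) - 2 * ((j + 1 : ℕ) : ℤ) + 1)) * qφ (j + m) a b c q (j + 1) *
        (if m = 0 then 0 else splitP (j + m) a b c q (m - 1) i) =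
    qθ (j + m) c q i * splitP (j + m) a b c q m i + splitP (j + m) a b c q m (i + 1) := by
  rw [diagAe_eq _ h4]
  rcases m with _ | m
  · rw [splitP_row_succ, splitP_zero_succ]
    simp only [if_true]
    generalize splitP _ a b c q 0 i = t
    generalize hD : q ^ 2 - q⁻¹ ^ 2 = D at *
    have hI := zpow_ne_zero (i : ℤ) hq
    have hJ := zpow_ne_zero (j : ℤ) hq
    simp only [qθ, qφ, splitRow, splitCol, Nat.cast_add, Nat.cast_one, Nat.cast_zero, two_mul,
      neg_add, zpow_sub₀ hq, zpow_add₀ hq, zpow_neg, add_zero, zpow_zero, zpow_one]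
    generalize q ^ (i : ℤ) = I at *
    generalize q ^ (j : ℤ) = J at *
    field_simp
    rw [← hD]
    field_simp
    ring
  · rw [splitP_row_succ, splitP_row_succ, splitP_succ_succ _ _ _ _ hq]
    simp only [Nat.add_eq_zero_iff, one_ne_zero, and_false, if_false, Nat.add_sub_cancel]
    generalize splitP _ a b c q m i = t
    generalize hD : q ^ 2 - q⁻¹ ^ 2 = D at *
    have hI := zpow_ne_zero (i : ℤ) hq
    have hJ := zpow_ne_zero (j : ℤ) hq
    have hM := zpow_ne_zero (m : ℤ) hq
    simp only [qθ, qφ, splitRow, splitCol, Nat.cast_add, Nat.cast_one, two_mul,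
      neg_add, zpow_sub₀ hq, zpow_add₀ hq, zpow_neg, zpow_one]
    generalize q ^ (i : ℤ) = I at *
    generalize q ^ (j : ℤ) = J at *
    generalize q ^ (m : ℤ) = M at *
    field_simp
    rw [← hD]
    field_simp
    ring

/-- Entrywise form of `A* P = P A^ε(c, a⁻¹, b)`, simplified by means of `splitP_matA`. -/
theorem splitP_matAs {a b c q : K} (ha : a ≠ 0) (hb : b ≠ 0) (hc : c ≠ 0) (hq : q ≠ 0)
    (h4 : q ^ 2 - q⁻¹ ^ 2 ≠ 0) (j m i : ℕ) :
    qθ (j + m) b q j * splitP (j + m) a b c q m i +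
      qφ (j + m) a b c q (j + 1) * (if m = 0 then 0 else splitP (j + m) a b c q (m - 1) i) =
    splitP (j + m) a b c q m i * diagAe (j + m) c a⁻¹ b q i +
      splitP (j + m) a b c q m (i + 1) *
        -((a⁻¹)⁻¹ * q ^ (((j + m : ℕ) : ℤ) - 2 * ((i + 1 : ℕ) : ℤ) + 1)) +
      -(c⁻¹ * q ^ (((j + m : ℕ) : ℤ) - 2 * (i : ℤ) + 1)) *
        ((qθ (j + m) a q j - qθ (j + m) a⁻¹ q i) * splitP (j + m) a b c q m i +
          splitP (j + m) a b c q (m + 1) i) := by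
  rw [diagAe_eq _ h4]
  rcases m with _ | m
  · rw [splitP_row_succ, splitP_zero_succ]
    simp only [if_true]
    generalize splitP _ a b c q 0 i = t
    generalize hD : q ^ 2 - q⁻¹ ^ 2 = D at *
    have hI := zpow_ne_zero (i : ℤ) hq
    have hJ := zpow_ne_zero (j : ℤ) hq
    simp only [qθ, qφ, splitRow, splitCol, Nat.cast_add, Nat.cast_one, Nat.cast_zero, two_mul,
      neg_add, zpow_sub₀ hq, zpow_add₀ hq, zpow_neg, add_zero, zpow_zero, zpow_one]
    generalize q ^ (i : ℤ) = I at *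
    generalize q ^ (j : ℤ) = J at *
    field_simp
    rw [← hD]
    field_simp
    ring
  · rw [splitP_succ_succ _ _ _ _ hq, splitP_row_succ _ _ _ _ _ (m + 1), splitP_row_succ _ _ _ _ _ m]
    simp only [Nat.add_eq_zero_iff, one_ne_zero, and_false, if_false, Nat.add_sub_cancel]
    generalize splitP _ a b c q m i = t
    generalize hD : q ^ 2 - q⁻¹ ^ 2 = D at *
    have hI := zpow_ne_zero (i : ℤ) hq
    have hJ := zpow_ne_zero (j : ℤ) hq
    have hM := zpow_ne_zero (m : ℤ) hq
    simp only [qθ, qφ, splitRow, splitCol, Nat.cast_add, Nat.cast_one, two_mul,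
      neg_add, zpow_sub₀ hq, zpow_add₀ hq, zpow_neg, zpow_one]
    generalize q ^ (i : ℤ) = I at *
    generalize q ^ (j : ℤ) = J at *
    generalize q ^ (m : ℤ) = M at *
    field_simp
    rw [← hD]
    field_simp
    ring

theorem splitP_eq_zero (d : ℕ) (a b c q : K) {m i : ℕ} (h : i < m) :
    splitP d a b c q m i = 0 := by
  have : ∏ l ∈ Finset.range m,
      ((q ^ ((i : ℤ) - l) - q ^ ((l : ℤ) - i)) * q ^ (i : ℤ)) = 0 :=
    Finset.prod_eq_zero (i := i) (by simpa using h) (by simp)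
  rw [splitP, this, mul_zero]

theorem IsSplitAdmissible.rotate {d : ℕ} {a b c q : K} (h : IsSplitAdmissible d a b c q) :
    IsSplitAdmissible d c a⁻¹ b q := by
  obtain ⟨⟨ha, hb, hc, hq⟩, h2, h4⟩ := h
  refine ⟨⟨hc, inv_ne_zero ha, hb, hq⟩, h2, fun i hi hid => ?_⟩
  obtain ⟨-, e2, -, -⟩ := h4 i hi hid
  obtain ⟨e1, -, -, -⟩ := h4 i hi hid
  obtain ⟨-, -, f3, f4⟩ := h4 (d + 1 - i) (by omega) (by omega)
  have hcast : (d : ℤ) - 2 * ((d + 1 - i : ℕ) : ℤ) + 1 = -((d : ℤ) - 2 * i + 1) := by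
    rw [Nat.cast_sub (by omega)]
    push_cast
    ring
  rw [hcast, zpow_neg] at f3 f4
  refine ⟨fun h => e2 (by rw [← h]; ring), fun h => f3 ?_, fun h => e1 ?_, fun h => f4 ?_⟩
  · rw [← h]
    simp only [mul_inv, inv_inv]
    ring
  · rw [← h, inv_inv]
    ring
  · rw [← h]
    simp only [mul_inv, inv_inv]
    ring

theorem zpow_sub_zpow_ne_zero {d : ℕ} {q : K} (hq : q ≠ 0)
    (h2 : ∀ i : ℕ, 1 ≤ i → i ≤ d → q ^ (2 * i) ≠ 1) {n : ℤ} (h0 : 1 ≤ n) (hd : n ≤ d) :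
    q ^ n - q ^ (-n) ≠ 0 := by
  obtain ⟨k, rfl⟩ := Int.eq_ofNat_of_zero_le (show 0 ≤ n by omega)
  intro h
  refine h2 k (by omega) (by omega) ?_
  rw [sub_eq_zero, zpow_neg, zpow_natCast] at h
  rw [two_mul, pow_add]
  nth_rewrite 1 [h]
  exact inv_mul_cancel₀ (pow_ne_zero _ hq)

theorem IsSplitAdmissible.splitCol_ne_zero {d : ℕ} {a b c q : K}
    (h : IsSplitAdmissible d a b c q) {i : ℕ} (hi : i < d) : splitCol d a b c q i ≠ 0 := by
  obtain ⟨⟨ha, hb, hc, hq⟩, h2, h4⟩ := h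
  have e := zpow_sub_zpow_ne_zero hq h2 (n := (d : ℤ) - i) (by omega) (by omega)
  rw [neg_sub] at e
  refine mul_ne_zero (mul_ne_zero (mul_ne_zero (neg_ne_zero.2 (inv_ne_zero hc)) hq) e) ?_
  intro h
  refine (h4 (d - i) (by omega) (by omega)).2.2.2 ?_
  rw [Nat.cast_sub hi.le, show (d : ℤ) - 2 * (d - i) + 1 = (i - d) - (-i - 1) by ring,
    zpow_sub₀ hq, eq_div_iff (zpow_ne_zero _ hq), sub_eq_zero.1 h]
  field_simp

theorem IsSplitAdmissible.splitRow_ne_zero {d : ℕ} {a b c q : K}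
    (h : IsSplitAdmissible d a b c q) {m : ℕ} (hm : m < d) : splitRow d a b c q m ≠ 0 := by
  obtain ⟨⟨ha, hb, hc, hq⟩, h2, h4⟩ := h
  refine mul_ne_zero (mul_ne_zero (mul_ne_zero (neg_ne_zero.2 hb) hc) (zpow_ne_zero _ hq)) ?_
  intro h
  refine (h4 (d - m) (by omega) (by omega)).1 ?_
  rw [sub_eq_zero] at h
  rw [Nat.cast_sub hm.le, show (d : ℤ) - 2 * (d - m) + 1 = 2 * m + 1 - d by ring,
    ← mul_one (a * b * c), h]
  field_simp

theorem IsSplitAdmissible.splitP_self_ne_zero {d : ℕ} {a b c q : K}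
    (h : IsSplitAdmissible d a b c q) {i : ℕ} (hi : i ≤ d) : splitP d a b c q i i ≠ 0 := by
  have hq := h.1.2.2.2
  refine mul_ne_zero (mul_ne_zero ?_ ?_) ?_ <;>
    refine Finset.prod_ne_zero_iff.2 fun k hk => ?_ <;> rw [Finset.mem_range] at hk
  · exact h.splitCol_ne_zero (by omega)
  · exact h.splitRow_ne_zero (by omega)
  · refine mul_ne_zero ?_ (zpow_ne_zero _ hq)
    rw [← neg_sub (i : ℤ) k]
    exact zpow_sub_zpow_ne_zero hq h.2.1 (by omega) (by omega)

theorem IsSplitAdmissible.isUnit_natMat {d : ℕ} {a b c q : K}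
    (h : IsSplitAdmissible d a b c q) :
    IsUnit (natMat d fun j i => splitP d a b c q (d - j) i) := by
  set P := natMat d fun j i => splitP d a b c q (d - j) i
  have hrev : P.submatrix Fin.revPerm id = natMat d (splitP d a b c q) := by
    ext i j
    have := i.isLt
    simp only [P, natMat, Matrix.submatrix_apply, Matrix.of_apply, Fin.revPerm_apply,
      Fin.val_rev, id]
    congr 1
    omega
  have hdet := Matrix.det_permute Fin.revPerm P
  have hup : (natMat d (splitP d a b c q)).IsUpperTriangular :=
    fun i j hij => splitP_eq_zero d a b c q (Fin.lt_def.1 hij)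
  rw [hrev, Matrix.det_of_isUpperTriangular hup] at hdet
  rw [Matrix.isUnit_iff_isUnit_det, isUnit_iff_ne_zero]
  intro h0
  rw [h0, mul_zero, Finset.prod_eq_zero_iff] at hdet
  obtain ⟨i, -, hi⟩ := hdet
  exact h.splitP_self_ne_zero (Nat.lt_succ_iff.1 i.isLt) hi

theorem IsSplitAdmissible.sq_sub_ne_zero {d : ℕ} {a b c q : K}
    (h : IsSplitAdmissible d a b c q) (hd : 2 ≤ d) : q ^ 2 - q ^ (-2 : ℤ) ≠ 0 := by
  simpa using zpow_sub_zpow_ne_zero h.1.2.2.2 h.2.1 (n := 2) (by omega) (by omega)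

/-- The Leonard systems attached to `(a, b, c)` and `(c, a⁻¹, b)` are related by a
cyclic rotation of the three matrices. -/
theorem IsSplitAdmissible.exists_rotation {d : ℕ} {a b c q : K} (hd : 2 ≤ d)
    (h : IsSplitAdmissible d a b c q) :
    ∃ P : Matrix (Fin (d + 1)) (Fin (d + 1)) K, IsUnit P ∧
      matA d a q * P = P * matAs d c a⁻¹ b q ∧
      matAs d a b c q * P = P * matAe d c a⁻¹ b q ∧
      matAe d a b c q * P = P * matA d c q := by
  have h4 := h.sq_sub_ne_zero hd
  have h4' : q ^ 2 - q⁻¹ ^ 2 ≠ 0 := by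
    rwa [inv_pow, ← zpow_ofNat q 2, ← zpow_neg, zpow_ofNat]
  obtain ⟨ha, hb, hc, hq⟩ := h.1
  have hrow (j m i : ℕ) (t : K) (hi : i < j + m + 1) :
      (if j = 0 then 0 else t * splitP (j + m) a b c q (j + m - (j - 1)) i) =
        t * splitP (j + m) a b c q (m + 1) i := by
    rcases j with _ | j
    · rw [if_pos rfl, zero_add, splitP_eq_zero _ _ _ _ _ (by omega), mul_zero]
    · rw [if_neg (Nat.succ_ne_zero j)]
      congr 2
      omega
  have hrow' (j m i : ℕ) (t : K) :
      (if j < j + m then t * splitP (j + m) a b c q (j + m - (j + 1)) i else 0) =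
        t * (if m = 0 then 0 else splitP (j + m) a b c q (m - 1) i) := by
    rcases m with _ | m
    · simp
    · rw [if_pos (by omega), if_neg (Nat.succ_ne_zero m)]
      congr 2
      omega
  have hcol (n m i : ℕ) (t : K) (hi : i < n + 1) :
      (if i < n then splitP n a b c q m (i + 1) * t else 0) =
        splitP n a b c q m (i + 1) * t := by
    split_ifs with h
    · rfl
    · rw [show i = n by omega, splitP_col_succ_self, zero_mul]
  have hcol' (j m i : ℕ) (t : K) :
      (if i = 0 then 0 else splitP (j + m) a b c q m (i - 1) *
          (t * qφ (j + m) c a⁻¹ b q i)) =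
        t * ((qθ (j + m) a q j - qθ (j + m) a⁻¹ q i) * splitP (j + m) a b c q m i +
          splitP (j + m) a b c q (m + 1) i) := by
    rcases i with _ | i
    · rw [if_pos rfl, splitP_matA_zero, mul_zero]
    · rw [splitP_matA ha hb hc hq, if_neg (Nat.succ_ne_zero i), Nat.add_sub_cancel]
      ring
  refine ⟨_, h.isUnit_natMat, ?_, ?_, ?_⟩
  · rw [matA_eq_tridiag, matAs_eq_tridiag]
    ext ⟨j, hj⟩ ⟨i, hi⟩
    obtain ⟨m, rfl⟩ : ∃ m, d = j + m := ⟨d - j, by omega⟩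
    have key := hcol' j m i 1
    simp only [one_mul] at key
    rw [tridiag_mul, mul_tridiag]
    simp only [hrow j m i 1 hi, Nat.add_sub_cancel_left, key, zero_mul, mul_zero, ite_self]
    ring
  · rw [matAs_eq_tridiag, matAe_eq_tridiag hc (inv_ne_zero ha) hq h4]
    ext ⟨j, hj⟩ ⟨i, hi⟩
    obtain ⟨m, rfl⟩ : ∃ m, d = j + m := ⟨d - j, by omega⟩
    rw [tridiag_mul, mul_tridiag]
    simp only [hrow j m i _ hi, hrow', hcol _ m i _ hi, hcol', Nat.add_sub_cancel_left]
    rw [← splitP_matAs ha hb hc hq h4']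
    ring
  · rw [matA_eq_tridiag, matAe_eq_tridiag ha hb hq h4]
    ext ⟨j, hj⟩ ⟨i, hi⟩
    obtain ⟨m, rfl⟩ : ∃ m, d = j + m := ⟨d - j, by omega⟩
    have key := hcol (j + m) m i 1 hi
    simp only [mul_one] at key
    rw [tridiag_mul, mul_tridiag]
    simp only [hrow j m i _ hi, hrow', Nat.add_sub_cancel_left, mul_zero, ite_self, add_zero,
      mul_one, key]
    rw [mul_comm (splitP _ _ _ _ _ _ _) (qθ _ _ _ _), ← splitP_matAe ha hb hc hq h4']
    ring

end Rotation

section EigenBases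

variable {K : Type*} [Field K] {n : ℕ}

/-- All entries above the superdiagonal vanish, and no entry of the superdiagonal does. -/
def IsHess (X : Matrix (Fin n) (Fin n) K) : Prop :=
  ∀ i j : Fin n, ((i : ℕ) + 1 < j → X i j = 0) ∧ ((i : ℕ) + 1 = j → X i j ≠ 0)

theorem IsIrredTrid.isHess {X : Matrix (Fin n) (Fin n) K} (h : IsIrredTrid X) : IsHess X := by
  refine fun i j => ⟨fun hij => ?_, fun hij => h.2 i j (Or.inr hij.symm)⟩
  by_contra h0
  have := h.1 i j h0
  omega

theorem IsHess.eq_zero_of_mulVec {X : Matrix (Fin (n + 1)) (Fin (n + 1)) K} (h : IsHess X) {μ : K}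
    {v : Fin (n + 1) → K} (hv : X.mulVec v = μ • v) (h0 : v 0 = 0) : v = 0 := by
  have key : ∀ k : ℕ, ∀ hk : k < n + 1, v ⟨k, hk⟩ = 0 := by
    intro k
    induction k using Nat.strong_induction_on with
    | _ k ih =>
      intro hk
      rcases k with _ | k
      · exact h0
      · have hrow := congrFun hv ⟨k, by omega⟩
        rw [Pi.smul_apply, ih k (by omega), smul_zero, Matrix.mulVec, dotProduct,
          Finset.sum_eq_single ⟨k + 1, hk⟩] at hrow
        · exact (mul_eq_zero.1 hrow).resolve_left ((h _ _).2 rfl)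
        · intro j _ hj
          rcases lt_or_gt_of_ne (fun e => hj (Fin.ext e) : (j : ℕ) ≠ k + 1) with hlt | hlt
          · rw [show v j = 0 from ih j hlt j.isLt, mul_zero]
          · rw [(h _ _).1 hlt, zero_mul]
        · simp
  ext k
  exact key k k.isLt

theorem IsHess.eigenvalues_injective {X U : Matrix (Fin (n + 1)) (Fin (n + 1)) K} (h : IsHess X)
    (hU : IsUnit U) {e : Fin (n + 1) → K} (hXU : X * U = U * Matrix.diagonal e) :
    Function.Injective e := by
  have hcol (i) : X.mulVec (U.col i) = e i • U.col i := by
    ext k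
    have := congrFun (congrFun hXU k) i
    rwa [Matrix.mul_apply, Matrix.mul_diagonal, mul_comm] at this
  have hinj := Matrix.mulVec_injective_of_isUnit hU
  have hne (i) : U 0 i ≠ 0 := fun h0 => by
    have hz := h.eq_zero_of_mulVec (hcol i) h0
    have := hinj (a₁ := Pi.single i 1) (a₂ := 0)
      (by rw [Matrix.mulVec_single_one, hz, Matrix.mulVec_zero])
    simpa using congrFun this i
  intro i j hij
  by_contra hne'
  have hz := h.eq_zero_of_mulVec (μ := e i) (v := U 0 j • U.col i - U 0 i • U.col j)
    (by rw [Matrix.mulVec_sub, Matrix.mulVec_smul, Matrix.mulVec_smul, hcol, hcol, ← hij]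
        module) (by simp [Matrix.col, mul_comm])
  have := hinj (a₁ := U 0 j • Pi.single i 1 - U 0 i • Pi.single j 1) (a₂ := 0)
    (by rw [Matrix.mulVec_sub, Matrix.mulVec_smul, Matrix.mulVec_smul, Matrix.mulVec_single_one,
          Matrix.mulVec_single_one, hz, Matrix.mulVec_zero])
  have := congrFun this i
  simp [hne'] at this
  exact hne j this

theorem charpoly_eq_of_mul_eq {X Y P : Matrix (Fin n) (Fin n) K} (hP : IsUnit P)
    (h : X * P = P * Y) : X.charpoly = Y.charpoly := by
  obtain ⟨P, rfl⟩ := hP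
  rw [← Matrix.charpoly_units_conj P Y, ← h, mul_assoc, ← Matrix.coe_units_inv, Units.mul_inv,
    mul_one]

theorem IsLeonardTriple.multFree {X Y Z : Matrix (Fin (n + 1)) (Fin (n + 1)) K}
    (h : IsLeonardTriple X Y Z) : MultFree Z := by
  obtain ⟨⟨S, hS, -, -, hZ⟩, -, ⟨T, hT, hD, -, -⟩⟩ := h
  have hdet := (Matrix.isUnit_iff_isUnit_det T).1 hT
  have hdetS := (Matrix.isUnit_iff_isUnit_det S).1 hS
  obtain ⟨e, he⟩ : ∃ e, T⁻¹ * Z * T = Matrix.diagonal e := ⟨_, hD.diagonal_diag.symm⟩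
  have hZT : Z * T = T * Matrix.diagonal e := by
    rw [← he, mul_assoc, Matrix.mul_nonsing_inv_cancel_left _ _ hdet]
  refine ⟨e, hZ.isHess.eigenvalues_injective (U := S⁻¹ * T)
    ((Matrix.isUnit_nonsing_inv_iff.2 hS).mul hT) ?_, ?_⟩
  · rw [mul_assoc, Matrix.mul_nonsing_inv_cancel_left _ _ hdetS, mul_assoc, hZT, mul_assoc]
  · rw [charpoly_eq_of_mul_eq hT hZT, Matrix.charpoly_diagonal]

/-- If two eigenbases of the same matrix, ordered oppositely, both bring a second matrix to
Hessenberg form, then the second matrix is irreducible tridiagonal in the first basis. -/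
theorem IsHess.isIrredTrid {N M G : Matrix (Fin n) (Fin n) K} {θ : Fin n → K}
    (hN : IsHess N) (hM : IsHess M) (hθ : Function.Injective θ) (hG : IsUnit G)
    (hθG : Matrix.diagonal θ * G = G * Matrix.diagonal (θ ∘ Fin.rev)) (hNG : N * G = G * M) :
    IsIrredTrid N := by
  have hoff (i j : Fin n) (hij : i ≠ j.rev) : G i j = 0 := by
    have := congrFun (congrFun hθG i) j
    rw [Matrix.diagonal_mul, Matrix.mul_diagonal, mul_comm, ← sub_eq_zero, ← mul_sub] at this
    exact (mul_eq_zero.1 this).resolve_right (sub_ne_zero.2 fun e => hij (hθ e))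
  have hne (i : Fin n) : G i i.rev ≠ 0 := fun h0 => by
    have hinv := Matrix.mul_nonsing_inv G ((Matrix.isUnit_iff_isUnit_det G).1 hG)
    have := congrFun (congrFun hinv i) i
    rw [Matrix.mul_apply, Finset.sum_eq_single i.rev, h0, zero_mul, Matrix.one_apply_eq] at this
    · exact zero_ne_one this
    · intro k _ hk
      rw [hoff i k fun e => hk (by rw [e, Fin.rev_rev]), zero_mul]
    · simp
  have hentry (i j : Fin n) : N i j * G j j.rev = G i i.rev * M i.rev j.rev := by
    have := congrFun (congrFun hNG i) j.rev
    rwa [Matrix.mul_apply, Matrix.mul_apply, Finset.sum_eq_single j, Finset.sum_eq_single i.rev]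
      at this
    · intro k _ hk
      rw [hoff i k fun e => hk (by rw [e, Fin.rev_rev]), zero_mul]
    · simp
    · intro k _ hk
      rw [hoff k _ (by rwa [Fin.rev_rev]), mul_zero]
    · simp
  refine ⟨fun i j h0 => ?_, fun i j hij => ?_⟩
  · by_contra hcon
    rcases lt_or_ge (i : ℕ) j with hlt | hge
    · exact h0 ((hN i j).1 (by omega))
    · have := hentry i j
      rw [(hM i.rev j.rev).1 (by simp only [Fin.val_rev]; omega), mul_zero] at this
      exact h0 ((mul_eq_zero.1 this).resolve_right (hne j))
  · rcases hij with hij | hij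
    · intro h0
      have := hentry i j
      rw [h0, zero_mul] at this
      exact mul_ne_zero (hne i) ((hM i.rev j.rev).2 (by simp only [Fin.val_rev]; omega)) this.symm
    · exact (hN i j).2 hij.symm

theorem LTcond.of_mul_eq {X Y Z X' Y' Z' P : Matrix (Fin n) (Fin n) K} (h : LTcond X' Y' Z')
    (hP : IsUnit P) (hX : X * P = P * X') (hY : Y * P = P * Y') (hZ : Z * P = P * Z') :
    LTcond X Y Z := by
  obtain ⟨S, hS, h1, h2, h3⟩ := h
  have hdet := (Matrix.isUnit_iff_isUnit_det P).1 hP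
  have conj {W W' : Matrix (Fin n) (Fin n) K} (hW : W * P = P * W') :
      (P * S)⁻¹ * W * (P * S) = S⁻¹ * W' * S := by
    rw [Matrix.mul_inv_rev, mul_assoc, ← mul_assoc W, hW, mul_assoc P, mul_assoc S⁻¹,
      Matrix.nonsing_inv_mul_cancel_left _ _ hdet, mul_assoc]
  exact ⟨P * S, hP.mul hS, by rwa [conj hX], by rwa [conj hY], by rwa [conj hZ]⟩

end EigenBases

theorem multFree_iff_of_charpoly {K : Type*} [Field K] {n : ℕ} {X : Matrix (Fin n) (Fin n) K}
    {f : Fin n → K} (h : X.charpoly = ∏ i, (Polynomial.X - Polynomial.C (f i))) :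
    MultFree X ↔ Function.Injective f := by
  refine ⟨fun ⟨e, he, hX⟩ => ?_, fun hf => ⟨f, hf, h⟩⟩
  have roots_eq (g : Fin n → K) :
      (∏ i, (Polynomial.X - Polynomial.C (g i))).roots = Finset.univ.val.map g := by
    rw [← Polynomial.roots_multiset_prod_X_sub_C (Finset.univ.val.map g), Multiset.map_map]
    rfl
  have hef : Finset.univ.val.map e = Finset.univ.val.map f := by
    rw [← roots_eq e, ← roots_eq f, ← hX, h]
  have hnd : (Finset.univ.val.map f).Nodup := hef ▸ (Multiset.nodup_map_iff_of_injective he).2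
    Finset.univ.nodup
  exact fun i j hij => Multiset.inj_on_of_nodup_map hnd i (Finset.mem_univ i) j
    (Finset.mem_univ j) hij

section QRacah

variable {K : Type*} [Field K] {d : ℕ} {a b c q : K}

theorem charpoly_matA (a q : K) :
    (matA d a q).charpoly = ∏ i : Fin (d + 1), (Polynomial.X - Polynomial.C (qθ d a q i)) := by
  have hup : (matA d a q).transpose.IsUpperTriangular := fun i j hij => by
    have : (j : ℕ) < i := hij
    simp only [matA, Matrix.transpose_apply, Matrix.of_apply]
    rw [if_neg (by omega), if_neg (by omega)]
  rw [← Matrix.charpoly_transpose, Matrix.charpoly_of_isUpperTriangular _ hup]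
  simp [matA]

theorem qθ_sub (a : K) (hq : q ≠ 0) (i j : ℕ) :
    qθ d a q i - qθ d a q j = (q ^ ((i : ℤ) - j) - q ^ (-((i : ℤ) - j))) *
      (a * q ^ ((i : ℤ) + j - d) - a⁻¹ * q ^ ((d : ℤ) - (i + j))) := by
  simp only [qθ, zpow_sub₀ hq, zpow_add₀ hq, zpow_neg, two_mul]
  field_simp
  ring

theorem qθ_inv {i : ℕ} (hi : i ≤ d) (a q : K) : qθ d a⁻¹ q i = qθ d a q (d - i) := by
  rw [qθ, qθ, Nat.cast_sub hi, inv_inv, add_comm]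
  congr 3 <;> ring

theorem qθ_injective_iff (ha : a ≠ 0) (hq : q ≠ 0)
    (h2 : ∀ i : ℕ, 1 ≤ i → i ≤ d → q ^ (2 * i) ≠ 1) :
    Function.Injective (fun i : Fin (d + 1) => qθ d a q i) ↔
      ∀ i : ℕ, 1 ≤ i → i ≤ 2 * d - 1 → a ^ 2 ≠ q ^ (2 * (d : ℤ) - 2 * (i : ℤ)) := by
  have hfac (n : ℤ) : a * q ^ (n - d) - a⁻¹ * q ^ (d - n) = 0 ↔
      a ^ 2 = q ^ (2 * (d : ℤ) - 2 * n) := by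
    have e1 : q ^ (n - d) = (q ^ (d - n))⁻¹ := by rw [← zpow_neg, neg_sub]
    have e2 : q ^ (2 * (d : ℤ) - 2 * n) = (q ^ (d - n)) ^ 2 := by
      rw [← zpow_natCast, ← zpow_mul]
      congr 1
      push_cast
      ring
    have := zpow_ne_zero (d - n) hq
    rw [e1, e2, sub_eq_zero]
    generalize q ^ ((d : ℤ) - n) = t at *
    field_simp
  constructor
  · intro h n h1 hn hcon
    obtain ⟨i, j, hi, hj, hij, rfl⟩ : ∃ i j : ℕ, i < d + 1 ∧ j < d + 1 ∧ i ≠ j ∧ n = i + j := by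
      rcases le_total n d with h | h
      · exact ⟨n, 0, by omega, by omega, by omega, rfl⟩
      · exact ⟨d, n - d, by omega, by omega, by omega, by omega⟩
    refine hij (Fin.mk.inj (h (a₁ := ⟨i, hi⟩) (a₂ := ⟨j, hj⟩) ?_))
    rw [← sub_eq_zero]
    dsimp only
    rw [qθ_sub a hq]
    have := (hfac ((i + j : ℕ) : ℤ)).2 hcon
    push_cast at this
    rw [this, mul_zero]
  · intro h
    have key : ∀ i j : Fin (d + 1), i < j → qθ d a q j ≠ qθ d a q i := by
      intro i j hij hcon
      have hlt : (i : ℕ) < j := hij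
      have := j.isLt
      rw [← sub_eq_zero, qθ_sub a hq] at hcon
      refine h (i + j) (by omega) (by omega) ((hfac _).1 ?_)
      push_cast
      rw [add_comm (i : ℤ)]
      exact (mul_eq_zero.1 hcon).resolve_left
        (zpow_sub_zpow_ne_zero hq h2 (by omega) (by omega))
    intro i j hij
    by_contra hne
    rcases lt_or_gt_of_ne hne with hlt | hlt
    · exact key i j hlt hij.symm
    · exact key j i hlt hij

theorem IsSplitAdmissible.qφ_ne_zero (h : IsSplitAdmissible d a b c q) {i : ℕ} (h1 : 1 ≤ i)
    (hid : i ≤ d) : qφ d a b c q i ≠ 0 := by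
  obtain ⟨⟨ha, hb, hc, hq⟩, h2, h4⟩ := h
  have hlast (x : K) (hx : x ≠ q ^ ((d : ℤ) - 2 * (i : ℤ) + 1)) :
      q ^ (-(i : ℤ)) - x * q ^ ((i : ℤ) - d - 1) ≠ 0 := fun h0 => hx <| by
    rw [show (d : ℤ) - 2 * i + 1 = -i - (i - d - 1) by ring, zpow_sub₀ hq, sub_eq_zero.1 h0,
      mul_div_cancel_right₀ _ (zpow_ne_zero _ hq)]
  have e := zpow_sub_zpow_ne_zero hq h2 (n := (d : ℤ) - i + 1) (by omega) (by omega)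
  rw [← neg_ne_zero, neg_sub, show -((d : ℤ) - i + 1) = i - d - 1 by ring] at e
  refine mul_ne_zero (mul_ne_zero (mul_ne_zero (mul_ne_zero (mul_ne_zero (mul_ne_zero
    (inv_ne_zero ha) (inv_ne_zero hb)) (zpow_ne_zero _ hq)) ?_) e) ?_) ?_
  · exact zpow_sub_zpow_ne_zero hq h2 (by omega) (by omega)
  · exact hlast _ (h4 i h1 hid).1
  · exact hlast _ (h4 i h1 hid).2.2.2

theorem IsSplitAdmissible.exists_isHess (h : IsSplitAdmissible d a b c q)
    (hθ : Function.Injective (fun i : Fin (d + 1) => qθ d a q i)) :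
    ∃ S : Matrix (Fin (d + 1)) (Fin (d + 1)) K, IsUnit S ∧
      matA d a q * S = S * Matrix.diagonal (fun i : Fin (d + 1) => qθ d a q i) ∧
      IsHess (S⁻¹ * matAs d a b c q * S) := by
  let s : ℕ → ℕ → K := fun j i =>
    if i ≤ j then ∏ k ∈ Finset.Ioc i j, (qθ d a q i - qθ d a q k)⁻¹ else 0
  have s_self (i : ℕ) : s i i = 1 := by simp [s]
  have s_lt {i j : ℕ} (hij : j < i) : s j i = 0 := if_neg (by omega)
  have s_succ {i j : ℕ} (hij : i ≤ j) :
      s (j + 1) i = s j i * (qθ d a q i - qθ d a q (j + 1))⁻¹ := by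
    simp only [s]
    rw [if_pos hij, if_pos (by omega), Finset.prod_Ioc_succ_top hij]
  have hlow : (natMat d s).IsLowerTriangular := fun i j hij => s_lt hij
  have hS : IsUnit (natMat d s) := by
    rw [Matrix.isUnit_iff_isUnit_det, Matrix.det_of_isLowerTriangular _ hlow]
    simp [natMat, s_self]
  refine ⟨natMat d s, hS, ?_, ?_⟩
  · rw [matA_eq_tridiag]
    ext j i
    rw [tridiag_mul, Matrix.mul_diagonal]
    simp only [zero_mul, ite_self, add_zero, one_mul, natMat, Matrix.of_apply]
    rcases lt_trichotomy (i : ℕ) j with hij | hij | hij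
    · have hne : qθ d a q i - qθ d a q j ≠ 0 := sub_ne_zero.2 fun e => hij.ne (by rw [hθ e])
      obtain ⟨k, hk⟩ : ∃ k, (j : ℕ) = k + 1 := ⟨j - 1, by omega⟩
      rw [hk] at hne ⊢
      rw [s_succ (by omega), if_neg (Nat.succ_ne_zero k), Nat.add_sub_cancel]
      field_simp
      ring
    · rw [hij, s_self]
      split_ifs with h0
      · ring
      · rw [s_lt (by omega)]
        ring
    · rw [s_lt hij, s_lt (by omega)]
      simp
  · set N := (natMat d s)⁻¹ * matAs d a b c q * natMat d s with hN
    have hSN : natMat d s * N = matAs d a b c q * natMat d s := by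
      rw [hN, mul_assoc, Matrix.mul_nonsing_inv_cancel_left _ _
        ((Matrix.isUnit_iff_isUnit_det _).1 hS)]
    have hentry (i j : Fin (d + 1)) (hij : i < j) : (natMat d s * N) i j =
        if (i : ℕ) + 1 = j then qφ d a b c q j else 0 := by
      have hlt : (i : ℕ) < j := hij
      have := j.isLt
      rw [hSN, matAs_eq_tridiag, tridiag_mul, s_lt hlt, if_pos (show (i : ℕ) < d by omega)]
      split_ifs with h0 h1 h1
      · rw [h1, s_self]
        ring
      · rw [s_lt (show (i : ℕ) + 1 < j by omega)]
        ring
      · rw [h1, s_self, s_lt (show (i : ℕ) - 1 < j by omega)]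
        ring
      · rw [s_lt (show (i : ℕ) + 1 < j by omega), s_lt (show (i : ℕ) - 1 < j by omega)]
        ring
    have hrow (i j : Fin (d + 1)) (hij : i < j) (h0 : ∀ k < i, N k j = 0) :
        N i j = if (i : ℕ) + 1 = j then qφ d a b c q j else 0 := by
      rw [← hentry i j hij, Matrix.mul_apply, Finset.sum_eq_single i]
      · simp [natMat, s_self]
      · intro k _ hk
        rcases lt_or_gt_of_ne hk with hlt | hlt
        · rw [h0 k hlt, mul_zero]
        · rw [hlow hlt, zero_mul]
      · simp
    have hzero (i j : Fin (d + 1)) : (i : ℕ) + 1 < j → N i j = 0 := by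
      induction i using WellFoundedLT.induction with
      | _ i ih =>
        intro hij
        rw [hrow i j (Fin.lt_def.2 (by omega)) fun k hk => ih k hk (by
          have := Fin.lt_def.1 hk
          omega), if_neg hij.ne]
    intro i j
    refine ⟨hzero i j, fun hij => ?_⟩
    rw [hrow i j (Fin.lt_def.2 (by omega)) fun k hk => hzero k j (by
      have := Fin.lt_def.1 hk
      omega), if_pos hij]
    exact h.qφ_ne_zero (by omega) (by omega)

/-- `A^ε` is irreducible tridiagonal in any basis in which `A` is diagonal and `A*` is
irreducible tridiagonal. -/
theorem isIrredTrid_conj_matAe (ha : a ≠ 0) (hq : q ≠ 0) (h4 : q ^ 2 - q ^ (-2 : ℤ) ≠ 0)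
    {S : Matrix (Fin (d + 1)) (Fin (d + 1)) K} (hS : IsUnit S)
    (hAS : matA d a q * S = S * Matrix.diagonal (fun i : Fin (d + 1) => qθ d a q i))
    (hN : IsIrredTrid (S⁻¹ * matAs d a b c q * S)) :
    IsIrredTrid (S⁻¹ * matAe d a b c q * S) := by
  have hdet := (Matrix.isUnit_iff_isUnit_det S).1 hS
  set N := S⁻¹ * matAs d a b c q * S with hNdef
  set D := Matrix.diagonal (fun i : Fin (d + 1) => qθ d a q i)
  have hND : S⁻¹ * (matAs d a b c q * matA d a q) * S = N * D := by
    rw [hNdef, mul_assoc, mul_assoc, hAS, ← mul_assoc, ← mul_assoc]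
  have hDN : S⁻¹ * (matA d a q * matAs d a b c q) * S = D * N := by
    have : S⁻¹ * matA d a q = D * S⁻¹ := by
      rw [← Matrix.mul_nonsing_inv_cancel_right S (S⁻¹ * matA d a q) hdet, mul_assoc S⁻¹, hAS,
        Matrix.nonsing_inv_mul_cancel_left _ _ hdet]
    rw [hNdef, ← mul_assoc, this, mul_assoc D, mul_assoc D]
  have hentry (i j : Fin (d + 1)) (hij : i ≠ j) : (S⁻¹ * matAe d a b c q * S) i j =
      (q ^ 2 - q ^ (-2 : ℤ))⁻¹ * (q⁻¹ * qθ d a q j - q * qθ d a q i) * N i j := by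
    rw [matAe, mul_add, add_mul, Matrix.mul_smul, Matrix.smul_mul, mul_sub, sub_mul,
      Matrix.mul_smul, Matrix.mul_smul, Matrix.smul_mul, Matrix.smul_mul, hND, hDN,
      Matrix.mul_smul, Matrix.smul_mul, mul_one, Matrix.nonsing_inv_mul _ hdet]
    simp only [Matrix.add_apply, Matrix.smul_apply, Matrix.sub_apply, Matrix.one_apply_ne hij,
      smul_eq_mul, D, Matrix.mul_diagonal, Matrix.diagonal_mul]
    ring
  refine ⟨fun i j h0 => ?_, fun i j hij => ?_⟩
  · by_cases hij : i = j
    · exact Or.inl (congrArg _ hij)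
    · rw [hentry i j hij] at h0
      exact hN.1 i j (right_ne_zero_of_mul h0)
  · rw [hentry i j (fun e => by subst e; omega)]
    refine mul_ne_zero (mul_ne_zero (inv_ne_zero h4) ?_) (hN.2 i j hij)
    rcases hij with hij | hij
    · rw [hij, qθ_comb_upper ha hq]
      exact mul_ne_zero (neg_ne_zero.2 h4) (mul_ne_zero ha (zpow_ne_zero _ hq))
    · rw [hij, qθ_comb_lower ha hq]
      exact mul_ne_zero (neg_ne_zero.2 h4) (mul_ne_zero (inv_ne_zero ha) (zpow_ne_zero _ hq))

/-- Inverting all three parameters gives a conjugate pair. -/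
theorem IsSplitAdmissible.exists_inversion (hd : 2 ≤ d) (h : IsSplitAdmissible d a b c q) :
    IsSplitAdmissible d a⁻¹ b⁻¹ c⁻¹ q ∧
    ∃ P : Matrix (Fin (d + 1)) (Fin (d + 1)) K, IsUnit P ∧
      matA d a q * P = P * matA d a⁻¹ q ∧
      matAs d a b c q * P = P * matAs d a⁻¹ b⁻¹ c⁻¹ q := by
  have h3 := h.rotate.rotate.rotate
  obtain ⟨P, hP, hA, hAs, -⟩ := h.exists_rotation hd
  obtain ⟨Q, hQ, -, hAs', hAe'⟩ := h.rotate.exists_rotation hd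
  obtain ⟨R, hR, hA'', -, hAe''⟩ := h.rotate.rotate.exists_rotation hd
  refine ⟨h3, P * Q * R, (hP.mul hQ).mul hR, ?_, ?_⟩
  · rw [← mul_assoc, ← mul_assoc, hA, mul_assoc P, hAs', mul_assoc P, mul_assoc Q, hAe'',
      ← mul_assoc, ← mul_assoc]
  · rw [← mul_assoc, ← mul_assoc, hAs, mul_assoc P, hAe', mul_assoc P, mul_assoc Q, hA'',
      ← mul_assoc, ← mul_assoc]

theorem IsSplitAdmissible.lTcond (hd : 2 ≤ d) (h : IsSplitAdmissible d a b c q)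
    (hθ : Function.Injective (fun i : Fin (d + 1) => qθ d a q i)) :
    LTcond (matA d a q) (matAs d a b c q) (matAe d a b c q) := by
  obtain ⟨h', P, hP, hA, hAs⟩ := h.exists_inversion hd
  have hrev : (fun i : Fin (d + 1) => qθ d a⁻¹ q i) =
      (fun i : Fin (d + 1) => qθ d a q i) ∘ Fin.rev := by
    ext i
    rw [qθ_inv (by omega), Function.comp_apply, Fin.val_rev]
    congr 1
    omega
  obtain ⟨S, hS, hAS, hN⟩ := h.exists_isHess hθ
  obtain ⟨T, hT, hAT, hM⟩ := h'.exists_isHess (hrev ▸ hθ.comp Fin.rev_injective)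
  have hdS := (Matrix.isUnit_iff_isUnit_det S).1 hS
  have hdT := (Matrix.isUnit_iff_isUnit_det T).1 hT
  rw [hrev] at hAT
  have hirr : IsIrredTrid (S⁻¹ * matAs d a b c q * S) := by
    refine hN.isIrredTrid hM hθ (G := S⁻¹ * (P * T))
      ((Matrix.isUnit_nonsing_inv_iff.2 hS).mul (hP.mul hT)) ?_ ?_
    · have : Matrix.diagonal (fun i : Fin (d + 1) => qθ d a q i) * S⁻¹ = S⁻¹ * matA d a q := by
        rw [← Matrix.mul_nonsing_inv_cancel_right S (S⁻¹ * matA d a q) hdS, mul_assoc S⁻¹, hAS,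
          Matrix.nonsing_inv_mul_cancel_left _ _ hdS]
      rw [← mul_assoc, this, mul_assoc, ← mul_assoc _ P, hA, mul_assoc P, hAT]
      simp only [mul_assoc]
    · rw [mul_assoc, Matrix.mul_nonsing_inv_cancel_left _ _ hdS, mul_assoc, ← mul_assoc _ P, hAs]
      simp only [mul_assoc]
      rw [Matrix.mul_nonsing_inv_cancel_left _ _ hdT]
  refine ⟨S, hS, ?_, hirr,
    isIrredTrid_conj_matAe h.1.1 h.1.2.2.2 (h.sq_sub_ne_zero hd) hS hAS hirr⟩
  rw [mul_assoc, hAS, Matrix.nonsing_inv_mul_cancel_left _ _ hdS]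
  exact Matrix.isDiag_diagonal _

end QRacah

/-- Theorem 14.5: (A,A*,A^ε) is a Leonard triple iff A^ε is multiplicity-free iff
c² is not among q^{2d−2}, q^{2d−4}, …, q^{2−2d}. -/
theorem stmt_15 {K : Type*} [Field K] [IsAlgClosed K] (d : ℕ) (hd : 3 ≤ d)
    (a b c q : K) (h : QRACred d a b c q) :
    (IsLeonardTriple (matA d a q) (matAs d a b c q) (matAe d a b c q) ↔
      MultFree (matAe d a b c q)) ∧
    (MultFree (matAe d a b c q) ↔
      ∀ i : ℕ, 1 ≤ i → i ≤ 2 * d - 1 → c ^ 2 ≠ q ^ (2 * (d : ℤ) - 2 * (i : ℤ))) := by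
  obtain ⟨⟨ha, hb, hc, hq⟩, h2, h3, h4⟩ := h
  have hadm : IsSplitAdmissible d a b c q := ⟨⟨ha, hb, hc, hq⟩, h2, h4⟩
  have hd2 : 2 ≤ d := by omega
  have hadm' := hadm.rotate
  have hadm'' := hadm'.rotate
  obtain ⟨P, hP, hA, hAs, hAe⟩ := hadm.exists_rotation hd2
  obtain ⟨Q, hQ, hA', hAs', hAe'⟩ := hadm'.exists_rotation hd2
  have hmf : MultFree (matAe d a b c q) ↔
      ∀ i : ℕ, 1 ≤ i → i ≤ 2 * d - 1 → c ^ 2 ≠ q ^ (2 * (d : ℤ) - 2 * (i : ℤ)) := by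
    rw [multFree_iff_of_charpoly ((charpoly_eq_of_mul_eq hP hAe).trans (charpoly_matA c q)),
      qθ_injective_iff hc hq h2]
  refine ⟨⟨fun hlt => hlt.multFree, fun hcmf => ⟨?_, ?_, ?_⟩⟩, hmf⟩
  · exact hadm.lTcond hd2 ((qθ_injective_iff ha hq h2).2 fun i h1 hi => (h3 i h1 hi).1)
  · have hb' := hadm''.lTcond hd2
      ((qθ_injective_iff hb hq h2).2 fun i h1 hi => (h3 i h1 hi).2)
    exact (hb'.of_mul_eq hQ hAe' hA' hAs').of_mul_eq hP hAs hAe hA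
  · have hc' := hadm'.lTcond hd2 ((qθ_injective_iff hc hq h2).2 (hmf.1 hcmf))
    exact hc'.of_mul_eq hP hAe hA hAs
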